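/- Let r ≥ 1, let Σ = diag(Σ₁,…,Σ_r) ∈ ℝ^{r×r} have positive diagonal entries, and let X, Y ∈ ℝ^{r×r} with rows x_kᵀ and y_kᵀ (k = 1,…,r) satisfy X·Yᵀ = Σ (so in particular ⟨x_k, y_k⟩ = Σ_k > 0 for all k, and all x_k, y_k are nonzero). For nonzero vectors u, v let angle(u,v) = arccos(⟨u,v⟩/(‖u‖·‖v‖)), and write α_k = angle(x_k, y_k) ∈ [0, π/2). Fix indices 1 ≤ i ≤ s ≤ r and a real D_i with 0 < D_i ≤ Σ_i/(12r), and assume α_i ≥ π/3 + π/(24r) and α_i ≤ α_j for every j with i < j ≤ s. Then there exist X′, Y′ ∈ ℝ^{r×r} with rows x_k′ᵀ, y_k′ᵀ such that: (a) X′·Y′ᵀ = Σ; (b) ‖x_k′‖ = ‖x_k‖ for every k, and ‖Y′ − Y‖_F² ≤ (4/5)·(D_i/Σ_i)·(‖Y‖_F² − ‖Y′‖_F²); (c) x_j′ = x_j for every j ≠ i, ‖x_i′ − x_i‖ ≤ (1/√3)·(D_i/Σ_i)·‖x_i‖, and ‖Y′ − Y‖_F ≤ (2/√3)·(D_i/Σ_i)·‖Y‖_F;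 (d) angle(x_l′, y_l′) ≥ α_l − π/(24r) for every l with i ≤ l ≤ s; (e) ‖y_k‖ ≥ ‖y_k′‖ ≥ ‖y_k‖ − ‖y_k‖/(10r) for every k; (f) ‖Y‖_F² − ‖Y′‖_F² ≥ (5/3)·(D_i/Σ_i)·‖y_i‖². -/

import Mathlib

open Matrix
open scoped Classical

noncomputable section

/-- Frobenius norm of a real matrix. -/
def frob {m n : ℕ} (A : Matrix (Fin m) (Fin n) ℝ) : ℝ :=
  Real.sqrt (∑ i, ∑ j, A i j ^ 2)

/-- Euclidean norm of the `i`-th row of a matrix. -/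
def rowNorm {m n : ℕ} (A : Matrix (Fin m) (Fin n) ℝ) (i : Fin m) : ℝ :=
  Real.sqrt (∑ j, A i j ^ 2)

/-- Frobenius inner product `⟨A,B⟩ = trace(AᵀB)`. -/
def finner {m n : ℕ} (A B : Matrix (Fin m) (Fin n) ℝ) : ℝ :=
  ∑ i, ∑ j, A i j * B i j

/-- Projection onto the set of entries indexed by `Ω` (other entries are set to `0`). -/
def projOmega {m n : ℕ} (Ω : Finset (Fin m × Fin n)) (A : Matrix (Fin m) (Fin n) ℝ) :
    Matrix (Fin m) (Fin n) ℝ :=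
  Matrix.of fun i j => if (i, j) ∈ Ω then A i j else 0

/-- `G₀(z) = (max{0, z-1})²`. -/
def G0 (z : ℝ) : ℝ := max 0 (z - 1) ^ 2

/-- `G₀′(z) = 2·max{0, z-1}`. -/
def G0' (z : ℝ) : ℝ := 2 * max 0 (z - 1)

/-- The matrix whose `i`-th row is the `i`-th row of `A` and whose other rows vanish. -/
def rowMat {m n : ℕ} (A : Matrix (Fin m) (Fin n) ℝ) (i : Fin m) :
    Matrix (Fin m) (Fin n) ℝ :=
  Matrix.of fun i' j => if i' = i then A i j else 0

/-- The regularizer `G(X,Y)`. -/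
def Greg {m n r : ℕ} (ρ β1 β2 βT : ℝ) (X : Matrix (Fin m) (Fin r) ℝ)
    (Y : Matrix (Fin n) (Fin r) ℝ) : ℝ :=
  ρ * ∑ i, G0 (3 * rowNorm X i ^ 2 / (2 * β1 ^ 2)) +
    ρ * ∑ j, G0 (3 * rowNorm Y j ^ 2 / (2 * β2 ^ 2)) +
    ρ * G0 (3 * frob X ^ 2 / (2 * βT ^ 2)) +
    ρ * G0 (3 * frob Y ^ 2 / (2 * βT ^ 2))

/-- The regularized objective `F̃(X,Y)`. -/
def Ftilde {m n r : ℕ} (Ω : Finset (Fin m × Fin n)) (M : Matrix (Fin m) (Fin n) ℝ)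
    (ρ β1 β2 βT : ℝ) (X : Matrix (Fin m) (Fin r) ℝ) (Y : Matrix (Fin n) (Fin r) ℝ) : ℝ :=
  (1 / 2) * frob (projOmega Ω (M - X * Yᵀ)) ^ 2 + Greg ρ β1 β2 βT X Y

/-- Gradient of the regularizer with respect to one of the factors. -/
def gradG1 {m r : ℕ} (ρ β βT : ℝ) (X : Matrix (Fin m) (Fin r) ℝ) :
    Matrix (Fin m) (Fin r) ℝ :=
  (∑ i, (ρ * G0' (3 * rowNorm X i ^ 2 / (2 * β ^ 2)) * (3 / β ^ 2)) • rowMat X i) +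
    (ρ * G0' (3 * frob X ^ 2 / (2 * βT ^ 2)) * (3 / βT ^ 2)) • X

/-- `∇_X F̃(X,Y)`. -/
def gradX {m n r : ℕ} (Ω : Finset (Fin m × Fin n)) (M : Matrix (Fin m) (Fin n) ℝ)
    (ρ β1 βT : ℝ) (X : Matrix (Fin m) (Fin r) ℝ) (Y : Matrix (Fin n) (Fin r) ℝ) :
    Matrix (Fin m) (Fin r) ℝ :=
  projOmega Ω (X * Yᵀ - M) * Y + gradG1 ρ β1 βT X

/-- `∇_Y F̃(X,Y)`. -/
def gradY {m n r : ℕ} (Ω : Finset (Fin m × Fin n)) (M : Matrix (Fin m) (Fin n) ℝ)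
    (ρ β2 βT : ℝ) (X : Matrix (Fin m) (Fin r) ℝ) (Y : Matrix (Fin n) (Fin r) ℝ) :
    Matrix (Fin n) (Fin r) ℝ :=
  (projOmega Ω (X * Yᵀ - M))ᵀ * X + gradG1 ρ β2 βT Y

/-- Membership in `K₁`. -/
def K1mem {m n r : ℕ} (β1 β2 : ℝ) (X : Matrix (Fin m) (Fin r) ℝ)
    (Y : Matrix (Fin n) (Fin r) ℝ) : Prop :=
  (∀ i, rowNorm X i ≤ β1) ∧ ∀ j, rowNorm Y j ≤ β2

/-- Membership in `K₂`. -/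
def K2mem {m n r : ℕ} (βT : ℝ) (X : Matrix (Fin m) (Fin r) ℝ)
    (Y : Matrix (Fin n) (Fin r) ℝ) : Prop :=
  frob X ≤ βT ∧ frob Y ≤ βT

/-- Membership in `K(t) = {(X,Y) : ‖M - XYᵀ‖_F ≤ t}`. -/
def Kmem {m n r : ℕ} (M : Matrix (Fin m) (Fin n) ℝ) (t : ℝ)
    (X : Matrix (Fin m) (Fin r) ℝ) (Y : Matrix (Fin n) (Fin r) ℝ) : Prop :=
  frob (M - X * Yᵀ) ≤ t

/-- Euclidean norm of a vector in `ℝ^r`. -/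
def vnorm {r : ℕ} (x : Fin r → ℝ) : ℝ := Real.sqrt (∑ j, x j ^ 2)

/-- Euclidean inner product of two vectors in `ℝ^r`. -/
def vdot {r : ℕ} (x y : Fin r → ℝ) : ℝ := ∑ j, x j * y j

/-- Angle between two (nonzero) vectors in `ℝ^r`. -/
def vangle {r : ℕ} (x y : Fin r → ℝ) : ℝ :=
  Real.arccos (vdot x y / (vnorm x * vnorm y))

section
open InnerProductGeometry

/-- trig core -/
lemma trig_core (α d w : ℝ) (hw : 0 < w) (hw1 : w ≤ 1) (hd : 0 < d) (hdw : d ≤ w / 12)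
    (hα : Real.pi / 3 + Real.pi * w / 24 ≤ α) (hα2 : α < Real.pi / 2) :
    ∃ θ : ℝ, 0 ≤ θ ∧ θ ≤ Real.pi * w / 24 ∧ Real.cos (α - θ) = (1 + d) * Real.cos α ∧
      2 * Real.sin (θ / 2) ≤ 1 / Real.sqrt 3 * d ∧
      Real.sin θ ≤ 2 / Real.sqrt 3 * d * Real.cos α := by
  have hpi := Real.pi_pos
  have hpi3 := Real.pi_gt_three
  have hpi4 := Real.pi_lt_d2
  have hpw : 0 < Real.pi * w := by positivity
  set t := Real.pi * w / 24 with ht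
  have htpos : 0 < t := by positivity
  have htle : t ≤ 0.14 := by rw [ht]; nlinarith
  have h3 : Real.sqrt 3 ^ 2 = 3 := Real.sq_sqrt (by norm_num)
  have h3p : 0 < Real.sqrt 3 := by positivity
  have h3b : 1.7 ≤ Real.sqrt 3 := Real.le_sqrt_of_sq_le (by norm_num)
  have hc0 : 0 < Real.cos α := Real.cos_pos_of_mem_Ioo ⟨by linarith, hα2⟩
  have hc1 : Real.cos α ≤ 1 / 2 := by
    rw [← Real.cos_pi_div_three]
    exact Real.cos_le_cos_of_nonneg_of_le_pi (by positivity) (by linarith) (by linarith)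
  have sinlb : ∀ x, Real.pi / 3 ≤ x → x ≤ Real.pi / 2 → Real.sqrt 3 / 2 ≤ Real.sin x := by
    intro x h1 h2
    rw [← Real.sin_pi_div_three]
    exact Real.sin_le_sin_of_le_of_le_pi_div_two (by linarith) h2 h1
  have hs := sinlb α (by linarith) hα2.le
  have hst : 2 / Real.pi * t ≤ Real.sin t := Real.mul_le_sin htpos.le (by linarith)
  have hst' : w / 12 ≤ Real.sin t := by
    have : 2 / Real.pi * t = w / 12 := by rw [ht]; field_simp; norm_num
    linarith
  have hct : 1 - t ^ 2 / 2 ≤ Real.cos t := Real.one_sub_sq_div_two_le_cos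
  have htw : t ≤ 0.14 * w := by rw [ht]; nlinarith
  have key : (1 + d) * Real.cos α ≤ Real.cos (α - t) := by
    rw [Real.cos_sub]
    have h1 : Real.cos α * (1.7 * (w/12)) ≤ Real.sin α * Real.sin t := by
      have : Real.cos α * 1.7 ≤ Real.sin α := by nlinarith
      nlinarith [mul_le_mul this hst' (by positivity) (by linarith)]
    have h2 : Real.cos α * (1 - t^2/2) ≤ Real.cos α * Real.cos t := by gcongr
    have h3 : t ^ 2 ≤ 0.14 * (0.14 * w) := by nlinarith
    nlinarith
  have hle1 : (1 + d) * Real.cos α ≤ 1 := key.trans (Real.cos_le_one _)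
  have hcβ : Real.cos (Real.arccos ((1 + d) * Real.cos α)) = (1 + d) * Real.cos α :=
    Real.cos_arccos (by nlinarith) hle1
  set β := Real.arccos ((1 + d) * Real.cos α) with hβ
  have hβα : β ≤ α := by
    have : Real.arccos (Real.cos α) = α := Real.arccos_cos (by linarith) (by linarith)
    rw [← this]
    apply Real.arccos_le_arccos
    nlinarith
  have hβt : α - t ≤ β := by
    have : Real.arccos (Real.cos (α - t)) = α - t := Real.arccos_cos (by linarith) (by linarith)
    rw [← this]
    exact Real.arccos_le_arccos key
  have hmid : 2 * Real.sin ((α - β) / 2) * Real.sin (α - (α - β)/2) = d * Real.cos α := by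
    have := Real.cos_sub_cos β α
    have e1 : (β + α)/2 = α - (α - β)/2 := by ring
    have e2 : (β - α)/2 = -((α - β)/2) := by ring
    rw [e1, e2, Real.sin_neg, hcβ] at this
    linarith
  have hsm := sinlb (α - (α - β)/2) (by linarith) (by linarith)
  have hsn : 0 ≤ Real.sin ((α - β) / 2) :=
    Real.sin_nonneg_of_nonneg_of_le_pi (by linarith) (by linarith)
  have hB : 2 * Real.sin ((α - β) / 2) ≤ 2 / Real.sqrt 3 * d * Real.cos α := by
    have : 2 * Real.sin ((α - β) / 2) * (Real.sqrt 3 / 2) ≤ d * Real.cos α := by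
      rw [← hmid]; gcongr
    have e : 2 / Real.sqrt 3 * d * Real.cos α = (d * Real.cos α) * 2 / Real.sqrt 3 := by ring
    rw [e, le_div_iff₀ h3p]; linarith
  refine ⟨α - β, by linarith, by linarith, by rw [sub_sub_cancel, hcβ], ?_, ?_⟩
  · refine hB.trans ?_
    have : 2 / Real.sqrt 3 * d * Real.cos α = 1 / Real.sqrt 3 * d * (2 * Real.cos α) := by ring
    rw [this]
    exact mul_le_of_le_one_right (by positivity) (by linarith)
  · refine le_trans ?_ hB
    have : Real.sin (α - β) = 2 * Real.sin ((α - β)/2) * Real.cos ((α - β)/2) := by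
      rw [← Real.sin_two_mul]; congr 1; ring
    rw [this]
    exact mul_le_of_le_one_right (by linarith) (Real.cos_le_one _)

variable {E : Type*} [NormedAddCommGroup E] [InnerProductSpace ℝ E]

lemma rot_lemma (x y : E) (S d w : ℝ) (hS : inner ℝ x y = S) (hS0 : 0 < S)
    (hw : 0 < w) (hw1 : w ≤ 1) (hd : 0 < d) (hdw : d ≤ w / 12)
    (hα : Real.pi / 3 + Real.pi * w / 24 ≤ angle x y) :
    ∃ a b τ : ℝ, ‖a • x + b • y‖ = ‖x‖ ∧ inner ℝ (a • x + b • y) y = (1 + d) * S ∧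
      ‖a • x + b • y - x‖ ≤ 1 / Real.sqrt 3 * d * ‖x‖ ∧
      angle x y - Real.pi * w / 24 ≤ angle (a • x + b • y) y ∧
      b * ‖y‖ ^ 2 = τ * ((1 + d) * S) ∧ 0 ≤ τ ∧
      τ * (1 + d) ≤ 4 / 3 * d ∧
      τ * Real.sin (angle x y) * (1 + d) ≤ 2 / Real.sqrt 3 * d := by
  have hx : 0 < ‖x‖ := norm_pos_iff.2 (by rintro rfl; simp at hS; linarith)
  have hy : 0 < ‖y‖ := norm_pos_iff.2 (by rintro rfl; simp at hS; linarith)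
  have hpi := Real.pi_pos
  have hpw : 0 < Real.pi * w := by positivity
  have hα2 : angle x y < Real.pi / 2 := by
    unfold angle
    rw [Real.arccos_lt_pi_div_two, hS]; positivity
  have hcos : S = ‖x‖ * ‖y‖ * Real.cos (angle x y) := by
    rw [← hS, ← cos_angle_mul_norm_mul_norm]; ring
  obtain ⟨θ, hθ0, hθ1, hcθ, hhalf, hsθ⟩ := trig_core _ d w hw hw1 hd hdw hα hα2
  set α := angle x y with hαdef
  have hs : Real.sqrt 3 / 2 ≤ Real.sin α := by
    rw [← Real.sin_pi_div_three]
    exact Real.sin_le_sin_of_le_of_le_pi_div_two (by linarith) hα2.le (by linarith)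
  have h3p : 0 < Real.sqrt 3 := by positivity
  have h3 : Real.sqrt 3 ^ 2 = 3 := Real.sq_sqrt (by norm_num)
  have hs0 : 0 < Real.sin α := by linarith
  have hc0 : 0 < Real.cos α := Real.cos_pos_of_mem_Ioo ⟨by linarith, hα2⟩
  have hsc := Real.sin_sq_add_cos_sq α
  have hscθ := Real.sin_sq_add_cos_sq θ
  rw [Real.cos_sub] at hcθ
  have hxx : inner ℝ x x = ‖x‖ ^ 2 := real_inner_self_eq_norm_sq x
  have hyy : inner ℝ y y = ‖y‖ ^ 2 := real_inner_self_eq_norm_sq y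
  have hyx : inner ℝ y x = S := by rw [real_inner_comm, hS]
  have hsinθ : 0 ≤ Real.sin θ := Real.sin_nonneg_of_nonneg_of_le_pi hθ0 (by linarith)
  obtain ⟨q, hq⟩ : ∃ q, q * Real.sin α = Real.sin θ := ⟨Real.sin θ / Real.sin α, by field_simp⟩
  have hq0 : 0 ≤ q := by
    by_contra h
    push Not at h
    nlinarith
  set a := Real.cos θ - q * Real.cos α with ha
  set b := q * ‖x‖ / ‖y‖ with hb
  have hby : b * ‖y‖ = q * ‖x‖ := by rw [hb]; field_simp
  have hin : inner ℝ (a • x + b • y) y = (1 + d) * S := by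
    rw [inner_add_left, real_inner_smul_left, real_inner_smul_left, hS, hyy]
    have : b * ‖y‖^2 = q * ‖x‖ * ‖y‖ := by rw [← hby]; ring
    rw [this, hcos]
    linear_combination ‖x‖ * ‖y‖ * (hcθ - q * hsc + Real.sin α * hq)
  have hinx : inner ℝ (a • x + b • y) x = ‖x‖ ^ 2 * Real.cos θ := by
    rw [inner_add_left, real_inner_smul_left, real_inner_smul_left, hyx, hxx]
    have : b * S = q * ‖x‖ ^ 2 * Real.cos α := by
      rw [hcos]; linear_combination ‖x‖ * Real.cos α * hby
    rw [this]; ring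
  have hnsq : ‖a • x + b • y‖ ^ 2 = ‖x‖ ^ 2 := by
    rw [← real_inner_self_eq_norm_sq, inner_add_right, real_inner_smul_right,
      real_inner_smul_right, hin, hinx]
    have : b * ((1 + d) * S) = ‖x‖ ^ 2 * q * ((1 + d) * Real.cos α) := by
      rw [hcos]; linear_combination (1 + d) * ‖x‖ * Real.cos α * hby
    rw [this, ← hcθ]
    linear_combination ‖x‖ ^ 2 * (hscθ + Real.sin θ * hq)
  have hnorm : ‖a • x + b • y‖ = ‖x‖ := by
    rw [← Real.sqrt_sq (norm_nonneg (a • x + b • y)), hnsq, Real.sqrt_sq hx.le]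
  have hsh : 0 ≤ Real.sin (θ / 2) := Real.sin_nonneg_of_nonneg_of_le_pi (by linarith) (by linarith)
  have hτs : q / ((1 + d) * Real.cos α) * Real.sin α * (1 + d) ≤ 2 / Real.sqrt 3 * d := by
    have : q / ((1 + d) * Real.cos α) * Real.sin α * (1 + d) = Real.sin θ / Real.cos α := by
      rw [← hq]; field_simp
    rw [this, div_le_iff₀ hc0]; exact hsθ
  have hτ0 : 0 ≤ q / ((1 + d) * Real.cos α) := by positivity
  refine ⟨a, b, q / ((1 + d) * Real.cos α), hnorm, hin, ?_, ?_, ?_, hτ0, ?_, hτs⟩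
  · have e : ‖a • x + b • y - x‖ ^ 2 = (2 * Real.sin (θ / 2) * ‖x‖) ^ 2 := by
      rw [norm_sub_sq_real, hnorm, hinx]
      have : Real.cos θ = 1 - 2 * Real.sin (θ/2) ^ 2 := by
        have h := Real.cos_sq' (θ/2)
        have h2 := Real.cos_two_mul (θ/2)
        rw [show 2 * (θ/2) = θ by ring] at h2
        linarith
      rw [this]; ring
    have := abs_eq_abs.2 (sq_eq_sq_iff_eq_or_eq_neg.1 e)
    rw [abs_of_nonneg (norm_nonneg _), abs_of_nonneg (by positivity)] at this
    rw [this]; gcongr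
  · have : angle (a • x + b • y) y = α - θ := by
      unfold angle
      rw [hin, hnorm, hcos]
      have : (1 + d) * (‖x‖ * ‖y‖ * Real.cos α) / (‖x‖ * ‖y‖) = Real.cos (α - θ) := by
        rw [Real.cos_sub, hcθ]; field_simp
      rw [this]
      exact Real.arccos_cos (by linarith) (by linarith)
    rw [this]; linarith
  · rw [hcos, pow_two, ← mul_assoc, hby]; field_simp
  · set τ := q / ((1 + d) * Real.cos α)
    have h1 : τ * (1 + d) * (Real.sqrt 3 / 2) ≤ 2 / Real.sqrt 3 * d := by
      refine le_trans ?_ hτs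
      calc τ * (1 + d) * (Real.sqrt 3 / 2) ≤ τ * (1 + d) * Real.sin α := by gcongr
        _ = _ := by ring
    have h2 : 2 / Real.sqrt 3 * d = (4 / 3 * d) * (Real.sqrt 3 / 2) := by
      field_simp; linarith
    rw [h2] at h1
    exact le_of_mul_le_mul_right h1 (by positivity)

lemma inner_sin_bound (x y z : E) (hx : 0 < ‖x‖) (hxz : inner ℝ x z = 0) :
    |inner ℝ y z| ≤ Real.sin (angle x y) * ‖y‖ * ‖z‖ := by
  have hcos : inner ℝ x y = ‖x‖ * ‖y‖ * Real.cos (angle x y) := by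
    rw [← cos_angle_mul_norm_mul_norm]; ring
  set u := y - (inner ℝ x y / ‖x‖ ^ 2) • x with hu
  have h1 : inner ℝ y z = inner ℝ u z := by
    rw [hu, inner_sub_left, real_inner_smul_left, hxz]; ring
  have h2 : ‖u‖ ^ 2 = (Real.sin (angle x y) * ‖y‖) ^ 2 := by
    rw [hu, norm_sub_sq_real, real_inner_smul_right, norm_smul, real_inner_comm x y, hcos, mul_pow,
      Real.norm_eq_abs, sq_abs, mul_pow, Real.sin_sq]
    field_simp; ring
  have hs : 0 ≤ Real.sin (angle x y) :=
    Real.sin_nonneg_of_nonneg_of_le_pi (angle_nonneg _ _) (angle_le_pi _ _)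
  have := abs_eq_abs.2 (sq_eq_sq_iff_eq_or_eq_neg.1 h2)
  rw [abs_of_nonneg (norm_nonneg _), abs_of_nonneg (by positivity)] at this
  rw [h1, ← this]
  exact abs_real_inner_le_norm u z

lemma angle_close (z z' : E) (ε w : ℝ) (hw : 0 < w) (hw1 : w ≤ 1) (hz : 0 < ‖z‖)
    (hε : ε ≤ w / 10) (h : ‖z' - z‖ ≤ ε * ‖z‖) : angle z z' ≤ Real.pi * w / 24 := by
  have hpi3 := Real.pi_gt_d2
  have hpi4 := Real.pi_lt_d2
  have hε0 : 0 ≤ ε := by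
    have := (norm_nonneg _).trans h
    exact nonneg_of_mul_nonneg_left this hz
  have hz' : (1 - ε) * ‖z‖ ≤ ‖z'‖ := by
    have := norm_sub_norm_le z z'
    rw [norm_sub_rev] at this; linarith
  have hz'0 : 0 < ‖z'‖ := lt_of_lt_of_le (by have : 0 < 1 - ε := by linarith
                                             positivity) hz'
  have e := norm_sub_sq_real z' z
  have hin : ‖z‖ * ‖z'‖ - ε^2 * ‖z‖^2 / 2 ≤ inner ℝ z z' := by
    rw [real_inner_comm]
    have : ‖z' - z‖^2 ≤ (ε * ‖z‖)^2 := by gcongr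
    nlinarith [sq_nonneg (‖z‖ - ‖z'‖)]
  set t := Real.pi * w / 24 with ht
  have ht0 : 0 < t := by positivity
  have htle : t ≤ 0.14 := by rw [ht]; nlinarith
  have htw : 0.13 * w ≤ t := by rw [ht]; nlinarith
  have hct := Real.cos_bound (x := t) (by rw [abs_of_pos ht0]; linarith)
  rw [abs_of_pos ht0] at hct
  have hct2 := (abs_le.1 hct).2
  have ht4 : t ^ 4 ≤ 0.02 * t ^ 2 := by
    have : t ^ 2 ≤ 0.14 ^ 2 := by gcongr
    have h5 : t ^ 4 = t ^ 2 * t ^ 2 := by ring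
    rw [h5]
    gcongr
    linarith
  have ht2 : (0.13 * w)^2 ≤ t ^ 2 := by gcongr
  have hct3 : Real.cos t ≤ 1 - 0.008 * w ^ 2 := by nlinarith
  have hε2 : ε^2 ≤ w^2/100 := by
    have : ε^2 ≤ (w/10)^2 := by gcongr
    linarith
  have hcos : Real.cos t ≤ Real.cos (angle z z') := by
    rw [cos_angle, le_div_iff₀ (by positivity)]
    refine le_trans ?_ hin
    have h1 : 0.9 * ‖z‖ ≤ ‖z'‖ := by nlinarith
    have h2 : ε^2 * ‖z‖^2 ≤ w^2/100 * ‖z‖^2 := by gcongr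
    have h3 : Real.cos t * (‖z‖ * ‖z'‖) ≤ (1 - 0.008 * w ^ 2) * (‖z‖ * ‖z'‖) := by gcongr
    have h4 : w^2 * (‖z‖ * (0.9 * ‖z‖)) ≤ w^2 * (‖z‖ * ‖z'‖) := by gcongr
    nlinarith [mul_nonneg (sq_nonneg w) (sq_nonneg ‖z‖)]
  by_contra hlt
  push Not at hlt
  have := Real.cos_lt_cos_of_nonneg_of_le_pi ht0.le (angle_le_pi z z') hlt
  linarith

/-- row lemma for k ≠ i -/
lemma row_lemma (x y z : E) (d w τ : ℝ) (hx : 0 < ‖x‖) (hy : 0 < ‖y‖) (hz : 0 < ‖z‖)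
    (hxz : inner ℝ x z = 0)
    (hw : 0 < w) (hw1 : w ≤ 1) (hd : 0 < d) (hdw : d ≤ w / 12) (hτ0 : 0 ≤ τ)
    (hτ : τ * (1 + d) ≤ 4 / 3 * d)
    (hτs : τ * Real.sin (angle x y) * (1 + d) ≤ 2 / Real.sqrt 3 * d)
    (z' : E) (hz' : z' = z - (τ * inner ℝ y z / ‖y‖ ^ 2) • y) :
    ‖z' - z‖ ^ 2 ≤ 4 / 5 * d * (‖z‖ ^ 2 - ‖z'‖ ^ 2) ∧
    ‖z' - z‖ ≤ 2 / Real.sqrt 3 * d * ‖z‖ ∧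
    angle z z' ≤ Real.pi * w / 24 ∧ ‖z'‖ ≤ ‖z‖ ∧ ‖z‖ - ‖z‖ * w / 10 ≤ ‖z'‖ := by
  have h3p : 0 < Real.sqrt 3 := by positivity
  have h3b : 1.7 ≤ Real.sqrt 3 := Real.le_sqrt_of_sq_le (by norm_num)
  have h3c : 2 / Real.sqrt 3 ≤ 1.2 := by rw [div_le_iff₀ h3p]; linarith
  have hsub : z' - z = -((τ * inner ℝ y z / ‖y‖ ^ 2) • y) := by rw [hz']; abel
  have hn : ‖z' - z‖ = τ * |inner ℝ y z| / ‖y‖ := by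
    rw [hsub, norm_neg, norm_smul, Real.norm_eq_abs, abs_div, abs_mul, abs_of_nonneg hτ0,
      abs_of_nonneg (sq_nonneg ‖y‖)]
    field_simp
  have hs : 0 ≤ Real.sin (angle x y) :=
    Real.sin_nonneg_of_nonneg_of_le_pi (angle_nonneg _ _) (angle_le_pi _ _)
  have hb := inner_sin_bound x y z hx hxz
  have hc1 : ‖z' - z‖ ≤ 2 / Real.sqrt 3 * d * ‖z‖ := by
    rw [hn, div_le_iff₀ hy]
    calc τ * |inner ℝ y z| ≤ τ * (Real.sin (angle x y) * ‖y‖ * ‖z‖) := by gcongr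
      _ = (τ * Real.sin (angle x y)) * (‖z‖ * ‖y‖) := by ring
      _ ≤ (2 / Real.sqrt 3 * d) * (‖z‖ * ‖y‖) := by
        refine mul_le_mul_of_nonneg_right ?_ (by positivity)
        refine le_trans ?_ hτs
        have : 0 ≤ τ * Real.sin (angle x y) := by positivity
        nlinarith
      _ = _ := by ring
  have hε : 2 / Real.sqrt 3 * d ≤ w / 10 := by nlinarith
  have hdiff : ‖z‖ ^ 2 - ‖z'‖ ^ 2 = (2 * τ - τ^2) * (inner ℝ y z / ‖y‖) ^ 2 := by
    rw [hz', norm_sub_sq_real, real_inner_smul_right, norm_smul, real_inner_comm y z, mul_pow,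
      Real.norm_eq_abs, sq_abs]
    field_simp; ring
  have hn2 : ‖z' - z‖ ^ 2 = τ^2 * (inner ℝ y z / ‖y‖) ^ 2 := by
    rw [hn, div_pow, mul_pow, sq_abs]; ring
  have hd12 : d ≤ 1 / 12 := by linarith
  have hτ1 : τ ≤ 4 / 3 * d := by nlinarith
  refine ⟨?_, hc1, angle_close z z' _ w hw hw1 hz hε hc1, ?_, ?_⟩
  · rw [hn2, hdiff, ← mul_assoc]
    gcongr
    have : τ ≤ 4/5 * d * (2 - τ) := by nlinarith
    nlinarith
  · have : 0 ≤ (2 * τ - τ^2) * (inner ℝ y z / ‖y‖) ^ 2 := by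
      apply mul_nonneg _ (sq_nonneg _)
      nlinarith
    rw [← hdiff] at this
    exact (sq_le_sq₀ (norm_nonneg _) (norm_nonneg _)).1 (by linarith)
  · have := norm_sub_norm_le z z'
    rw [norm_sub_rev] at this
    nlinarith [mul_le_mul_of_nonneg_right hε hz.le]

end

lemma vnorm_eq {r : ℕ} (v : Fin r → ℝ) : vnorm v = ‖WithLp.toLp 2 v‖ := by
  simp [vnorm, EuclideanSpace.norm_eq]

lemma vdot_eq {r : ℕ} (u v : Fin r → ℝ) :
    vdot u v = inner ℝ (WithLp.toLp 2 u) (WithLp.toLp 2 v) := by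
  simp [vdot, PiLp.inner_apply, mul_comm]

lemma vangle_eq {r : ℕ} (u v : Fin r → ℝ) :
    vangle u v = InnerProductGeometry.angle (WithLp.toLp 2 u) (WithLp.toLp 2 v) := by
  rw [vangle, InnerProductGeometry.angle, vdot_eq, vnorm_eq, vnorm_eq]

lemma frob_sq {r : ℕ} (A : Matrix (Fin r) (Fin r) ℝ) :
    frob A ^ 2 = ∑ k, ‖WithLp.toLp 2 (A k)‖ ^ 2 := by
  have h0 : 0 ≤ ∑ i, ∑ j, A i j ^ 2 :=
    Finset.sum_nonneg fun i _ => Finset.sum_nonneg fun j _ => sq_nonneg _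
  refine (Real.sq_sqrt h0).trans ?_
  refine Finset.sum_congr rfl fun k _ => ?_
  rw [← vnorm_eq, vnorm, Real.sq_sqrt (Finset.sum_nonneg fun j _ => sq_nonneg _)]

lemma mul_transpose_iff {r : ℕ} (A B : Matrix (Fin r) (Fin r) ℝ) (σ : Fin r → ℝ) :
    A * Bᵀ = Matrix.diagonal σ ↔
      ∀ j k, inner ℝ (WithLp.toLp 2 (A j)) (WithLp.toLp 2 (B k)) = if j = k then σ j else 0 := by
  rw [← Matrix.ext_iff]
  refine forall_congr' fun j => forall_congr' fun k => ?_
  rw [← vdot_eq, Matrix.mul_apply, Matrix.diagonal_apply]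
  rfl

/-- **Claim on Operation 2: rotation and shrinking.**
Indices: `i : Fin r` corresponds to the 1-based index `i+1`, and `s` is a 1-based bound,
so `1 ≤ i+1 ≤ s ≤ r` becomes `(i : ℕ) + 1 ≤ s ≤ r`, and `i < j ≤ s` (1-based) becomes
`i < j ∧ (j : ℕ) + 1 ≤ s`. -/
theorem stmt17 (r : ℕ) (hr : 1 ≤ r) (σ : Fin r → ℝ) (hσ : ∀ k, 0 < σ k)
    (X Y : Matrix (Fin r) (Fin r) ℝ) (hXY : X * Yᵀ = Matrix.diagonal σ)
    (i : Fin r) (s : ℕ) (his : (i : ℕ) + 1 ≤ s) (hsr : s ≤ r)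
    (Di : ℝ) (hDi0 : 0 < Di) (hDi : Di ≤ σ i / (12 * r))
    (hαi : Real.pi / 3 + Real.pi / (24 * r) ≤ vangle (X i) (Y i))
    (hαmin : ∀ j : Fin r, i < j → (j : ℕ) + 1 ≤ s → vangle (X i) (Y i) ≤ vangle (X j) (Y j)) :
    ∃ X' Y' : Matrix (Fin r) (Fin r) ℝ,
      X' * Y'ᵀ = Matrix.diagonal σ ∧
      (∀ k, vnorm (X' k) = vnorm (X k)) ∧
      frob (Y' - Y) ^ 2 ≤ 4 / 5 * (Di / σ i) * (frob Y ^ 2 - frob Y' ^ 2) ∧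
      (∀ j, j ≠ i → X' j = X j) ∧
      vnorm (X' i - X i) ≤ 1 / Real.sqrt 3 * (Di / σ i) * vnorm (X i) ∧
      frob (Y' - Y) ≤ 2 / Real.sqrt 3 * (Di / σ i) * frob Y ∧
      (∀ l : Fin r, i ≤ l → (l : ℕ) + 1 ≤ s →
        vangle (X l) (Y l) - Real.pi / (24 * r) ≤ vangle (X' l) (Y' l)) ∧
      (∀ k, vnorm (Y' k) ≤ vnorm (Y k) ∧
        vnorm (Y k) - vnorm (Y k) / (10 * r) ≤ vnorm (Y' k)) ∧
      5 / 3 * (Di / σ i) * vnorm (Y i) ^ 2 ≤ frob Y ^ 2 - frob Y' ^ 2 := by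
  have hr0 : (0 : ℝ) < r := by exact_mod_cast hr
  have hr1 : (1 : ℝ) ≤ r := by exact_mod_cast hr
  obtain ⟨w, hw⟩ : ∃ w : ℝ, w = 1 / r := ⟨_, rfl⟩
  obtain ⟨d, hd⟩ : ∃ d : ℝ, d = Di / σ i := ⟨_, rfl⟩
  have hσi := hσ i
  have hw0 : 0 < w := by rw [hw]; positivity
  have hw1 : w ≤ 1 := by rw [hw, div_le_one hr0]; exact hr1
  have hd0 : 0 < d := by rw [hd]; positivity
  have hdw : d ≤ w / 12 := by
    rw [hd, hw, div_le_iff₀ hσi]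
    refine hDi.trans (le_of_eq ?_)
    field_simp
  have hd12 : d ≤ 1 / 12 := by linarith
  have epi : Real.pi / (24 * r) = Real.pi * w / 24 := by rw [hw]; field_simp
  have e10 : ∀ v : ℝ, v / (10 * r) = v * w / 10 := by intro v; rw [hw]; field_simp
  rw [mul_transpose_iff] at hXY
  simp only [mul_transpose_iff, vnorm_eq, vangle_eq, epi, e10, ← hd] at *
  set x : Fin r → EuclideanSpace ℝ (Fin r) := fun k => WithLp.toLp 2 (X k) with hx
  set y : Fin r → EuclideanSpace ℝ (Fin r) := fun k => WithLp.toLp 2 (Y k) with hy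
  have hin : ∀ j k, inner ℝ (x j) (y k) = if j = k then σ j else 0 := hXY
  have hself : ∀ k, inner ℝ (x k) (y k) = σ k := fun k => by rw [hin, if_pos rfl]
  have hxpos : ∀ k, 0 < ‖x k‖ := fun k => norm_pos_iff.2 (by
    intro h
    have h1 := hself k
    rw [h, inner_zero_left] at h1
    exact (hσ k).ne h1)
  have hypos : ∀ k, 0 < ‖y k‖ := fun k => norm_pos_iff.2 (by
    intro h
    have h1 := hself k
    rw [h, inner_zero_right] at h1
    exact (hσ k).ne h1)
  obtain ⟨a, b, τ, hn, hi, hdist, hang, hbτ, hτ0, hτ, hτs⟩ :=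
    rot_lemma (x i) (y i) (σ i) d w (hself i) hσi hw0 hw1 hd0 hdw hαi
  obtain ⟨x', hx'⟩ : ∃ x' : Fin r → EuclideanSpace ℝ (Fin r),
      x' = Function.update x i (a • x i + b • y i) := ⟨_, rfl⟩
  obtain ⟨y', hy'⟩ : ∃ y' : Fin r → EuclideanSpace ℝ (Fin r),
      y' = Function.update (fun k => y k - (τ * inner ℝ (y i) (y k) / ‖y i‖ ^ 2) • y i) i
        ((1 / (1 + d)) • y i) := ⟨_, rfl⟩
  have hx'i : x' i = a • x i + b • y i := by rw [hx']; simp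
  have hx'j : ∀ j, j ≠ i → x' j = x j := fun j hj => by
    rw [hx', Function.update_of_ne hj]
  have hy'i : y' i = (1 / (1 + d)) • y i := by rw [hy']; simp
  have hy'j : ∀ k, k ≠ i → y' k = y k - (τ * inner ℝ (y i) (y k) / ‖y i‖ ^ 2) • y i :=
    fun k hk => by rw [hy', Function.update_of_ne hk]
  have hrow : ∀ k, k ≠ i → _ := fun k hk => row_lemma (x i) (y i) (y k) d w τ (hxpos i) (hypos i)
    (hypos k) (by rw [hin, if_neg (Ne.symm hk)]) hw0 hw1 hd0 hdw hτ0 hτ hτs (y' k) (hy'j k hk)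
  have h1d : 0 < 1 + d := by linarith
  have hy'in : ‖y' i‖ = ‖y i‖ / (1 + d) := by
    rw [hy'i, norm_smul, Real.norm_eq_abs, abs_of_pos (by positivity)]; ring
  have hdiffi : ‖y' i - y i‖ = d / (1 + d) * ‖y i‖ := by
    have : y' i - y i = (-(d / (1 + d))) • y i := by
      have h : -(d / (1 + d)) = 1 / (1 + d) - 1 := by field_simp; ring
      rw [h, sub_smul, one_smul, hy'i]
    rw [this, norm_smul, Real.norm_eq_abs, abs_neg, abs_of_pos (by positivity)]
  have h3p : 0 < Real.sqrt 3 := by positivity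
  have h3le : Real.sqrt 3 ≤ 2 := Real.sqrt_le_iff.2 ⟨by norm_num, by norm_num⟩
  have hddd : d / (1 + d) ≤ d := div_le_self hd0.le (by linarith)
  have hdec : ‖y i‖ ^ 2 - ‖y' i‖ ^ 2 = d * (2 + d) / (1 + d) ^ 2 * ‖y i‖ ^ 2 := by
    rw [hy'in]; field_simp; ring
  have hrowb : ∀ k, ‖y' k - y k‖ ^ 2 ≤ 4 / 5 * d * (‖y k‖ ^ 2 - ‖y' k‖ ^ 2) := by
    intro k
    by_cases hk : k = i
    · subst hk
      rw [hdiffi, hdec]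
      have : 4 / 5 * d * (d * (2 + d) / (1 + d) ^ 2 * ‖y k‖ ^ 2)
        = (d / (1 + d) * ‖y k‖) ^ 2 * (4 / 5 * (2 + d)) := by field_simp
      rw [this]
      exact le_mul_of_one_le_right (sq_nonneg _) (by linarith)
    · exact (hrow k hk).1
  have hrowc : ∀ k, ‖y' k - y k‖ ≤ 2 / Real.sqrt 3 * d * ‖y k‖ := by
    intro k
    by_cases hk : k = i
    · subst hk
      rw [hdiffi]
      gcongr
      refine hddd.trans ?_
      exact le_mul_of_one_le_left hd0.le ((one_le_div h3p).2 h3le)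
    · exact (hrow k hk).2.1
  have hrowe : ∀ k, ‖y' k‖ ≤ ‖y k‖ ∧ ‖y k‖ - ‖y k‖ * w / 10 ≤ ‖y' k‖ := by
    intro k
    by_cases hk : k = i
    · subst hk
      constructor
      · rw [hy'in]; exact div_le_self (norm_nonneg _) (by linarith)
      · have := norm_sub_norm_le (y k) (y' k)
        rw [norm_sub_rev, hdiffi] at this
        have h2 : d / (1 + d) * ‖y k‖ ≤ w / 10 * ‖y k‖ :=
          mul_le_mul_of_nonneg_right (by linarith) (norm_nonneg _)
        linarith
    · exact (hrow k hk).2.2.2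
  have hfY : frob Y ^ 2 = ∑ k, ‖y k‖ ^ 2 := frob_sq Y
  have hfY' : frob (Matrix.of fun k j => y' k j) ^ 2 = ∑ k, ‖y' k‖ ^ 2 := frob_sq _
  have hfD : frob ((Matrix.of fun k j => y' k j) - Y) ^ 2 = ∑ k, ‖y' k - y k‖ ^ 2 := frob_sq _
  refine ⟨Matrix.of fun k j => x' k j, Matrix.of fun k j => y' k j, ?_, ?_, ?_, ?_, ?_, ?_, ?_,
    hrowe, ?_⟩
  · intro j k
    change inner ℝ (x' j) (y' k) = _
    by_cases hj : j = i
    · subst hj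
      by_cases hk : k = j
      · subst hk
        rw [if_pos rfl, hy'i, hx'i, real_inner_smul_right, hi]; field_simp
      · rw [if_neg (Ne.symm hk), hy'j k hk, inner_sub_right, real_inner_smul_right, hx'i, hi,
          inner_add_left, real_inner_smul_left, real_inner_smul_left, hin, if_neg (Ne.symm hk)]
        have := hypos j
        field_simp
        linear_combination inner ℝ (y j) (y k) * hbτ
    · rw [hx'j j hj]
      by_cases hk : k = i
      · subst hk
        rw [if_neg hj, hy'i, real_inner_smul_right, hin, if_neg hj, mul_zero]
      · rw [hy'j k hk, inner_sub_right, real_inner_smul_right, hin, hin, if_neg hj]; ring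
  · intro k
    change ‖x' k‖ = ‖x k‖
    by_cases hk : k = i
    · subst hk; rw [hx'i, hn]
    · rw [hx'j k hk]
  · rw [hfD, hfY, hfY', ← Finset.sum_sub_distrib, Finset.mul_sum]
    exact Finset.sum_le_sum fun k _ => hrowb k
  · intro j hj
    change (fun m => x' j m) = _
    rw [hx'j j hj]
  · change ‖x' i - x i‖ ≤ _
    rw [hx'i]; exact hdist
  · have hf0 : ∀ A : Matrix (Fin r) (Fin r) ℝ, 0 ≤ frob A := fun A => Real.sqrt_nonneg _
    have h0 := hf0 Y
    refine (sq_le_sq₀ (hf0 _) (by positivity)).1 ?_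
    rw [hfD, mul_pow, hfY, Finset.mul_sum]
    refine Finset.sum_le_sum fun k _ => ?_
    rw [← mul_pow]
    exact pow_le_pow_left₀ (norm_nonneg _) (hrowc k) 2
  · intro l _ _
    change InnerProductGeometry.angle (x l) (y l) - _ ≤ InnerProductGeometry.angle (x' l) (y' l)
    by_cases hl : l = i
    · subst hl
      rw [hx'i, hy'i, InnerProductGeometry.angle_smul_right_of_pos _ _ (by positivity)]
      exact hang
    · rw [hx'j l hl]
      have h1 := InnerProductGeometry.angle_le_angle_add_angle (x l) (y' l) (y l)
      have h2 := (hrow l hl).2.2.1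
      rw [InnerProductGeometry.angle_comm] at h2
      linarith
  · rw [hfY, hfY', ← Finset.sum_sub_distrib]
    have h1 : ‖y i‖ ^ 2 - ‖y' i‖ ^ 2 ≤ ∑ k, (‖y k‖ ^ 2 - ‖y' k‖ ^ 2) := by
      refine Finset.single_le_sum (f := fun k => ‖y k‖ ^ 2 - ‖y' k‖ ^ 2) (fun k _ => ?_)
        (Finset.mem_univ i)
      have := pow_le_pow_left₀ (norm_nonneg _) (hrowe k).1 2
      simpa using this
    refine le_trans ?_ h1
    rw [hdec]
    change _ * ‖y i‖ ^ 2 ≤ _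
    gcongr
    rw [le_div_iff₀ (by positivity)]
    nlinarith [mul_pos hd0 hd0]

end
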